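/- Let K ⊂ ℝ^N be a convex body whose set of incenters M(K) = {x ∈ K : dist(x, ∂K) = r_K} has affine dimension k ∈ {1, …, N−1}. Then the center of mass of M(K) with respect to the k-dimensional Hausdorff measure, I_M = (∫_{M(K)} y dH^k(y)) / H^k(M(K)), belongs to the heart ♥(K). -/

import Mathlib

open MeasureTheory Set Metric
open scoped RealInnerProductSpace ENNReal NNReal

noncomputable section

/-- Reflection of `x` across the hyperplane `{z : ⟪z, ω⟫ = l}` (for a unit vector `ω`). -/
def reflectH {N : ℕ} (l : ℝ) (ω x : EuclideanSpace ℝ (Fin N)) : EuclideanSpace ℝ (Fin N) :=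
  x + (2 * (l - ⟪x, ω⟫)) • ω

/-- The maximal folding function of a set `K`:
`R_K(ω) = inf {l : the reflection of K ∩ {⟪·,ω⟫ ≥ l} across {⟪·,ω⟫ = l} lies in K}`. -/
def foldingFn {N : ℕ} (K : Set (EuclideanSpace ℝ (Fin N))) (ω : EuclideanSpace ℝ (Fin N)) : ℝ :=
  sInf {l : ℝ | reflectH l ω '' {x ∈ K | l ≤ ⟪x, ω⟫} ⊆ K}

/-- The heart of a set `K`. -/
def heart {N : ℕ} (K : Set (EuclideanSpace ℝ (Fin N))) : Set (EuclideanSpace ℝ (Fin N)) :=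
  {x ∈ K | ∀ ω : EuclideanSpace ℝ (Fin N), ‖ω‖ = 1 → ⟪x, ω⟫ ≤ foldingFn K ω}

/-- The set of incenters of `K` with inradius `r`: points of `K` at distance `r`
from the boundary of `K`. -/
def incenterSet {N : ℕ} (K : Set (EuclideanSpace ℝ (Fin N))) (r : ℝ) :
    Set (EuclideanSpace ℝ (Fin N)) :=
  {x ∈ K | Metric.infDist x (frontier K) = r}

theorem reflectH_reflectH {N : ℕ} (l : ℝ) {ω : EuclideanSpace ℝ (Fin N)} (hω : ‖ω‖ = 1)
    (x : EuclideanSpace ℝ (Fin N)) : reflectH l ω (reflectH l ω x) = x := by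
  have h : ⟪ω, ω⟫ = 1 := by rw [real_inner_self_eq_norm_sq, hω, one_pow]
  unfold reflectH
  rw [add_assoc, ← add_smul, inner_add_left, real_inner_smul_left, h]
  convert add_zero x
  rw [smul_eq_zero]
  left
  ring

theorem inner_reflectH {N : ℕ} (l : ℝ) {ω : EuclideanSpace ℝ (Fin N)} (hω : ‖ω‖ = 1)
    (x : EuclideanSpace ℝ (Fin N)) : ⟪reflectH l ω x, ω⟫ = 2 * l - ⟪x, ω⟫ := by
  have h : ⟪ω, ω⟫ = 1 := by rw [real_inner_self_eq_norm_sq, hω, one_pow]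
  unfold reflectH
  rw [inner_add_left, real_inner_smul_left, h]
  ring

theorem norm_sub_reflectH_sq {N : ℕ} (l : ℝ) {ω : EuclideanSpace ℝ (Fin N)} (hω : ‖ω‖ = 1)
    (x y : EuclideanSpace ℝ (Fin N)) :
    ‖x - reflectH l ω y‖ ^ 2 = ‖x - y‖ ^ 2 + 4 * (⟪x, ω⟫ - l) * (⟪y, ω⟫ - l) := by
  unfold reflectH
  rw [← sub_sub, norm_sub_sq_real (x - y), norm_smul, hω, real_inner_smul_right, inner_sub_left,
    mul_one, Real.norm_eq_abs, sq_abs]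
  ring

theorem isometry_reflectH {N : ℕ} (l : ℝ) {ω : EuclideanSpace ℝ (Fin N)} (hω : ‖ω‖ = 1) :
    Isometry (reflectH l ω) := by
  refine Isometry.of_dist_eq fun x y => ?_
  rw [dist_eq_norm, dist_eq_norm, ← sq_eq_sq₀ (norm_nonneg _) (norm_nonneg _),
    norm_sub_reflectH_sq l hω, norm_sub_rev, norm_sub_reflectH_sq l hω, inner_reflectH l hω,
    norm_sub_rev]
  ring

/-- The reflection across a hyperplane as an isometric equivalence. -/
def reflectHEquiv {N : ℕ} (l : ℝ) {ω : EuclideanSpace ℝ (Fin N)} (hω : ‖ω‖ = 1) :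
    EuclideanSpace ℝ (Fin N) ≃ᵢ EuclideanSpace ℝ (Fin N) :=
  IsometryEquiv.mk' (reflectH l ω) (reflectH l ω) (reflectH_reflectH l hω) (isometry_reflectH l hω)

/-- A measurable set that is mapped into itself by a folding has its center of mass on the lower
side of the folding hyperplane. -/
theorem setIntegral_inner_sub_nonpos {N : ℕ} {M : Set (EuclideanSpace ℝ (Fin N))} (d l : ℝ)
    {ω : EuclideanSpace ℝ (Fin N)} (hω : ‖ω‖ = 1) (hM : MeasurableSet M)
    (hint : IntegrableOn (fun y => ⟪y, ω⟫ - l) M (μH[d]))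
    (hfold : ∀ y ∈ M, l ≤ ⟪y, ω⟫ → reflectH l ω y ∈ M) :
    ∫ y in M, (⟪y, ω⟫ - l) ∂(μH[d]) ≤ 0 := by
  rw [← integral_indicator hM]
  have hgi := hint.integrable_indicator hM
  obtain ⟨g, hg⟩ : ∃ g, g = M.indicator fun y => ⟪y, ω⟫ - l := ⟨_, rfl⟩
  rw [← hg] at hgi ⊢
  have hT := (reflectHEquiv l hω).measurePreserving_hausdorffMeasure d
  have hTe : MeasurableEmbedding (reflectHEquiv l hω) :=
    (reflectHEquiv l hω).toHomeomorph.measurableEmbedding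
  have hcomp : ∫ y, g (reflectHEquiv l hω y) ∂(μH[d]) = ∫ y, g y ∂(μH[d]) :=
    hT.integral_comp hTe g
  have hci : Integrable (fun y => g (reflectHEquiv l hω y)) (μH[d]) :=
    (hT.integrable_comp_emb hTe).2 hgi
  have hsum : ∫ y, (g y + g (reflectHEquiv l hω y)) ∂(μH[d]) ≤ 0 := by
    refine integral_nonpos fun y => ?_
    change g y + g (reflectH l ω y) ≤ 0
    have h₁ : y ∈ M → l ≤ ⟪y, ω⟫ → reflectH l ω y ∈ M := hfold y
    have h₂ : reflectH l ω y ∈ M → l ≤ 2 * l - ⟪y, ω⟫ → y ∈ M := fun h hl => by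
      simpa only [reflectH_reflectH l hω] using
        hfold (reflectH l ω y) h (by rwa [inner_reflectH l hω])
    by_cases hy : y ∈ M <;> by_cases hy' : reflectH l ω y ∈ M
    · rw [hg, indicator_of_mem hy, indicator_of_mem hy', inner_reflectH l hω]
      linarith
    · rw [hg, indicator_of_mem hy, indicator_of_notMem hy', add_zero]
      by_contra! h
      exact hy' (h₁ hy (by linarith))
    · rw [hg, indicator_of_notMem hy, indicator_of_mem hy', inner_reflectH l hω, zero_add]
      by_contra! h
      exact hy (h₂ hy' (by linarith))
    · rw [hg, indicator_of_notMem hy, indicator_of_notMem hy', add_zero]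
  rw [integral_add hgi hci, hcomp] at hsum
  linarith

theorem ball_infDist_frontier_subset {E : Type*} [NormedAddCommGroup E] [NormedSpace ℝ E]
    [FiniteDimensional ℝ E] {K : Set E} (hK : K ≠ univ) {x : E} (hx : x ∈ K) :
    ball x (infDist x (frontier K)) ⊆ K := by
  intro z hz
  by_contra hzK
  obtain ⟨y, hy, hxy⟩ := exists_mem_frontier_infDist_compl_eq_dist hx hK
  have h₁ := infDist_le_dist_of_mem (x := x) hy
  have h₂ := infDist_le_dist_of_mem (x := x) (s := Kᶜ) hzK
  rw [mem_ball, dist_comm] at hz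
  linarith

theorem le_infDist_frontier_of_ball_subset {E : Type*} [PseudoMetricSpace E] {K : Set E}
    (hK : (frontier K).Nonempty) {x : E} {r : ℝ} (h : ball x r ⊆ K) :
    r ≤ infDist x (frontier K) := by
  refine (le_infDist hK).2 fun y hy => ?_
  by_contra! hlt
  exact hy.2 (interior_maximal h isOpen_ball (by rwa [mem_ball, dist_comm]))

/-- Incenters are the centers of the balls of radius `r` contained in `K`. -/
theorem incenterSet_eq {N : ℕ} {K : Set (EuclideanSpace ℝ (Fin N))} (hK : K ≠ univ)
    (hf : (frontier K).Nonempty) {r : ℝ} (hr : 0 < r)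
    (hmax : ∀ x ∈ K, infDist x (frontier K) ≤ r) :
    incenterSet K r = {x | ball x r ⊆ K} := by
  ext x
  constructor
  · rintro ⟨hx, rfl⟩
    exact ball_infDist_frontier_subset hK hx
  · intro hx
    have hxK : x ∈ K := hx (mem_ball_self hr)
    exact ⟨hxK, le_antisymm (hmax x hxK) (le_infDist_frontier_of_ball_subset hf hx)⟩

theorem convex_setOf_ball_subset {E : Type*} [NormedAddCommGroup E] [NormedSpace ℝ E]
    {K : Set E} (hK : Convex ℝ K) (r : ℝ) : Convex ℝ {x | ball x r ⊆ K} := by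
  intro x hx y hy a b ha hb hab z hz
  have hdecomp : z = a • (x + (z - (a • x + b • y))) + b • (y + (z - (a • x + b • y))) := by
    rw [smul_add, smul_add, add_add_add_comm, ← add_smul, hab, one_smul]
    abel
  rw [mem_ball, dist_eq_norm] at hz
  rw [hdecomp]
  exact hK (hx (by simpa [mem_ball, dist_eq_norm] using hz))
    (hy (by simpa [mem_ball, dist_eq_norm] using hz)) ha hb hab

/-- A folding of `K` into itself maps centers of balls contained in `K` to such centers. -/
theorem ball_reflectH_subset {N : ℕ} {K : Set (EuclideanSpace ℝ (Fin N))} {l r : ℝ}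
    {ω : EuclideanSpace ℝ (Fin N)} (hω : ‖ω‖ = 1)
    (hfold : reflectH l ω '' {x ∈ K | l ≤ ⟪x, ω⟫} ⊆ K) {y : EuclideanSpace ℝ (Fin N)}
    (hy : ball y r ⊆ K) (hl : l ≤ ⟪y, ω⟫) : ball (reflectH l ω y) r ⊆ K := by
  intro z hz
  rcases le_total l ⟪z, ω⟫ with hlz | hlz
  · apply hy
    refine lt_of_le_of_lt ?_ (mem_ball.1 hz)
    rw [dist_eq_norm, dist_eq_norm, ← sq_le_sq₀ (norm_nonneg _) (norm_nonneg _),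
      norm_sub_reflectH_sq l hω]
    nlinarith [mul_nonneg (sub_nonneg.2 hlz) (sub_nonneg.2 hl)]
  · rw [← reflectH_reflectH l hω z]
    refine hfold (mem_image_of_mem _ ⟨hy ?_, ?_⟩)
    · rw [mem_ball, ← (isometry_reflectH l hω).dist_eq, reflectH_reflectH l hω]
      exact hz
    · rw [inner_reflectH l hω]
      linarith

/-- A nonempty compact convex set has positive and finite Hausdorff measure in its affine
dimension. -/
theorem Convex.hausdorffMeasure_finrank_pos_lt_top {E : Type*} [NormedAddCommGroup E]
    [NormedSpace ℝ E] [FiniteDimensional ℝ E] [MeasurableSpace E] [BorelSpace E] {M : Set E}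
    (hconv : Convex ℝ M) (hcpt : IsCompact M) (hne : M.Nonempty) :
    0 < μH[(Module.finrank ℝ (affineSpan ℝ M).direction : ℝ)] M ∧
      μH[(Module.finrank ℝ (affineSpan ℝ M).direction : ℝ)] M < ∞ := by
  have := hne.coe_sort
  obtain ⟨p, hp⟩ := hne
  let p' : affineSpan ℝ M := ⟨p, subset_affineSpan _ _ hp⟩
  let e := (AffineIsometryEquiv.constVSub ℝ p').symm
  let f : (affineSpan ℝ M).direction → E := fun v => (e v : E)
  have hf : Isometry f := isometry_subtype_coe.comp e.isometry
  have hrange : M ⊆ range f := fun x hx =>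
    ⟨e.symm ⟨x, subset_affineSpan _ _ hx⟩, by simp [f]⟩
  have himage : f '' (f ⁻¹' M) = M := image_preimage_eq_of_subset hrange
  have hint : (interior (f ⁻¹' M)).Nonempty := by
    have hc : Convex ℝ (f ⁻¹' M) := hconv.affine_preimage
      ((affineSpan ℝ M).subtype.comp e.toAffineEquiv.toAffineMap)
    rw [hc.interior_nonempty_iff_affineSpan_eq_top]
    change affineSpan ℝ (e.toAffineEquiv ⁻¹' (((↑) : affineSpan ℝ M → E) ⁻¹' M)) = ⊤
    rw [← AffineSubspace.comap_span, affineSpan_coe_preimage_eq_top, AffineSubspace.comap_top]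
  have hcpt' : IsCompact (f ⁻¹' M) :=
    hf.isClosedEmbedding.isCompact_preimage hcpt
  rw [← himage, hf.hausdorffMeasure_image (Or.inl (Nat.cast_nonneg _)), himage]
  exact ⟨Measure.measure_pos_of_nonempty_interior _ hint, hcpt'.measure_lt_top⟩

/-- If the set of incenters of `K` has affine dimension `k ∈ {1,…,N-1}`, then its center
of mass with respect to the `k`-dimensional Hausdorff measure belongs to the heart. -/
theorem statement9 {N : ℕ} (K : Set (EuclideanSpace ℝ (Fin N)))
    (hKcpt : IsCompact K) (hKconv : Convex ℝ K) (hKint : (interior K).Nonempty)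
    (r : ℝ) (hr₁ : ∀ x ∈ K, Metric.infDist x (frontier K) ≤ r)
    (hr₂ : ∃ x ∈ K, Metric.infDist x (frontier K) = r)
    (k : ℕ) (hk₁ : 1 ≤ k) (hk₂ : k ≤ N - 1)
    (hdim : Module.finrank ℝ (affineSpan ℝ (incenterSet K r)).direction = k) :
    ((μH[(k : ℝ)] (incenterSet K r)).toReal)⁻¹ •
        (∫ y in incenterSet K r, y ∂(μH[(k : ℝ)])) ∈ heart K := by
  subst hdim
  obtain ⟨x₀, hx₀, hx₀r⟩ := hr₂
  have : Nontrivial (EuclideanSpace ℝ (Fin N)) :=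
    Module.nontrivial_of_finrank_pos (R := ℝ) (by rw [finrank_euclideanSpace_fin]; omega)
  have hKuniv : K ≠ univ := hKcpt.ne_univ
  have hfne : (frontier K).Nonempty := nonempty_frontier_iff.2 ⟨⟨x₀, hx₀⟩, hKuniv⟩
  have hr : 0 < r := by
    obtain ⟨z, hz⟩ := hKint
    obtain ⟨ε, hε, hball⟩ := Metric.mem_nhds_iff.1 (mem_interior_iff_mem_nhds.1 hz)
    exact hε.trans_le ((le_infDist_frontier_of_ball_subset hfne hball).trans
      (hr₁ z (interior_subset hz)))
  have hM := incenterSet_eq hKuniv hfne hr hr₁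
  have hMconv : Convex ℝ (incenterSet K r) := hM ▸ convex_setOf_ball_subset hKconv r
  have hMcpt : IsCompact (incenterSet K r) :=
    hKcpt.inter_right (isClosed_singleton.preimage (continuous_infDist_pt (frontier K)) :
      IsClosed ((fun x => infDist x (frontier K)) ⁻¹' {r}))
  obtain ⟨hpos, hfin⟩ :=
    hMconv.hausdorffMeasure_finrank_pos_lt_top hMcpt ⟨x₀, hx₀, hx₀r⟩
  set M := incenterSet K r
  set d : ℝ := (Module.finrank ℝ (affineSpan ℝ M).direction : ℝ)
  have hMmeas : MeasurableSet M := hMcpt.isClosed.measurableSet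
  have hint : IntegrableOn (fun y => y) M (μH[d]) := by
    obtain ⟨C, hC⟩ := hMcpt.isBounded.exists_norm_le
    exact Measure.integrableOn_of_bounded hfin.ne aestronglyMeasurable_id
      (ae_restrict_of_forall_mem hMmeas hC)
  have hmem : ((μH[d] M).toReal)⁻¹ • (∫ y in M, y ∂(μH[d])) ∈ M := by
    have h := hMconv.set_average_mem hMcpt.isClosed hpos.ne' hfin.ne
      (ae_restrict_mem hMmeas) hint
    rwa [setAverage_eq] at h
  refine ⟨hmem.1, fun ω hω => ?_⟩
  have hne : {l : ℝ | reflectH l ω '' {x ∈ K | l ≤ ⟪x, ω⟫} ⊆ K}.Nonempty := by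
    obtain ⟨C, hC⟩ := hKcpt.isBounded.exists_norm_le
    refine ⟨C + 1, ?_⟩
    rintro _ ⟨x, ⟨hx, hle⟩, rfl⟩
    have h := real_inner_le_norm x ω
    rw [hω, mul_one] at h
    linarith [hC x hx]
  refine le_csInf hne fun l hl => ?_
  have hfm : IsFiniteMeasure ((μH[d] : Measure (EuclideanSpace ℝ (Fin N))).restrict M) :=
    ⟨by rwa [Measure.restrict_apply_univ]⟩
  have hinner : IntegrableOn (fun y => ⟪y, ω⟫) M (μH[d]) := hint.inner_const ω
  have hconst : IntegrableOn (fun _ : EuclideanSpace ℝ (Fin N) => l) M (μH[d]) :=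
    integrable_const l
  have key := setIntegral_inner_sub_nonpos d l hω hMmeas (hinner.sub hconst) fun y hy hly => by
    rw [hM] at hy ⊢
    exact ball_reflectH_subset hω hl hy hly
  have hm : 0 < (μH[d] M).toReal := ENNReal.toReal_pos hpos.ne' hfin.ne
  have hswap : ∫ y in M, ⟪y, ω⟫ ∂(μH[d]) = ⟪∫ y in M, y ∂(μH[d]), ω⟫ := by
    simp_rw [real_inner_comm ω]
    exact integral_inner hint ω
  rw [integral_sub hinner hconst, setIntegral_const, smul_eq_mul, hswap, measureReal_def] at key
  rw [real_inner_smul_left, inv_mul_le_iff₀ hm]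
  linarith
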